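/- Let A and B be positive semidefinite n×n complex matrices and let f : [0,∞) → [0,∞) be a concave function. Then the operator norm of f(A+B) is at most the operator norm of f(A) + f(B). -/

import Mathlib

open Matrix ComplexOrder

/-- `f(A)` for a Hermitian matrix `A`: apply `f` to the eigenvalues in a spectral
decomposition of `A`. -/
noncomputable def matFn {n : ℕ} (f : ℝ → ℝ) (A : Matrix (Fin n) (Fin n) ℂ)
    (hA : A.IsHermitian) : Matrix (Fin n) (Fin n) ℂ :=
  (hA.eigenvectorUnitary : Matrix (Fin n) (Fin n) ℂ) *
    Matrix.diagonal (fun i => (f (hA.eigenvalues i) : ℂ)) *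
    (star hA.eigenvectorUnitary : Matrix (Fin n) (Fin n) ℂ)

theorem matFn_isHermitian {n : ℕ} (f : ℝ → ℝ) (A : Matrix (Fin n) (Fin n) ℂ)
    (hA : A.IsHermitian) : (matFn f A hA).IsHermitian := by
  have h1 : (Matrix.diagonal (fun i => (f (hA.eigenvalues i) : ℂ))).IsHermitian :=
    Matrix.isHermitian_diagonal_of_self_adjoint _ (by ext i; simp [Pi.star_def])
  have h2 := Matrix.isHermitian_mul_mul_conjTranspose
    (hA.eigenvectorUnitary : Matrix (Fin n) (Fin n) ℂ) h1
  simpa [matFn, Matrix.star_eq_conjTranspose] using h2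

/-- The sum of the `k` largest entries of `μ` (for the eigenvalue vector of a Hermitian
matrix, this is the Ky Fan `k`-sum of its eigenvalues). -/
noncomputable def sumKLargest {n : ℕ} (μ : Fin n → ℝ) (k : ℕ) : ℝ :=
  (((List.ofFn μ).insertionSort (· ≥ ·)).take k).sum

theorem isHermitian_sum_conj {n m : ℕ} (A Z : Fin m → Matrix (Fin n) (Fin n) ℂ)
    (hA : ∀ i, (A i).IsHermitian) : (∑ i, (Z i)ᴴ * A i * Z i).IsHermitian := by
  rw [Matrix.IsHermitian, Matrix.conjTranspose_sum]
  exact Finset.sum_congr rfl fun i _ =>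
    Matrix.isHermitian_conjTranspose_mul_mul (Z i) (hA i)

open scoped MatrixOrder Matrix.Norms.L2Operator in
/-- The operator norm is monotone on positive semidefinite matrices. -/
theorem norm_toEuclideanCLM_le_of_posSemidef {n : ℕ} {P M : Matrix (Fin n) (Fin n) ℂ}
    (hP : P.PosSemidef) (hPM : (M - P).PosSemidef) :
    ‖Matrix.toEuclideanCLM (𝕜 := ℂ) P‖ ≤ ‖Matrix.toEuclideanCLM (𝕜 := ℂ) M‖ := by
  change ‖P‖ ≤ ‖M‖
  exact CStarAlgebra.norm_le_norm_of_nonneg_of_le (Matrix.nonneg_iff_posSemidef.2 hP)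
    (Matrix.le_iff.2 hPM)

open scoped Matrix.Norms.L2Operator in
theorem norm_toEuclideanCLM_matFn {n : ℕ} (f : ℝ → ℝ) (A : Matrix (Fin n) (Fin n) ℂ)
    (hA : A.IsHermitian) :
    ‖Matrix.toEuclideanCLM (𝕜 := ℂ) (matFn f A hA)‖ =
      ‖fun i => (f (hA.eigenvalues i) : ℂ)‖ := by
  change ‖matFn f A hA‖ = _
  rw [matFn, ← Unitary.coe_star, CStarRing.norm_mul_coe_unitary,
    CStarRing.norm_coe_unitary_mul, Matrix.l2_opNorm_diagonal]

theorem matFn_id {n : ℕ} (A : Matrix (Fin n) (Fin n) ℂ) (hA : A.IsHermitian) :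
    matFn (fun t => t) A hA = A := by
  conv_rhs => rw [hA.spectral_theorem]
  rfl

theorem matFn_const {n : ℕ} (c : ℝ) (A : Matrix (Fin n) (Fin n) ℂ) (hA : A.IsHermitian) :
    matFn (fun _ => c) A hA = (c : ℂ) • 1 := by
  rw [matFn, ← Matrix.smul_one_eq_diagonal, Matrix.mul_smul, Matrix.smul_mul, mul_one,
    ← Unitary.coe_star, Unitary.coe_mul_star_self]

theorem matFn_mul_left {n : ℕ} (c : ℝ) (f : ℝ → ℝ) (A : Matrix (Fin n) (Fin n) ℂ)
    (hA : A.IsHermitian) :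
    matFn (fun t => c * f t) A hA = (c : ℂ) • matFn f A hA := by
  have h : Matrix.diagonal (fun i => ((c * f (hA.eigenvalues i) : ℝ) : ℂ)) =
      (c : ℂ) • Matrix.diagonal (fun i => (f (hA.eigenvalues i) : ℂ)) := by
    rw [← Matrix.diagonal_smul]
    congr 1
    ext i
    simp
  rw [matFn, matFn, h, Matrix.mul_smul, Matrix.smul_mul]

/-- Functional calculus is monotone in the function. -/
theorem matFn_sub_matFn_posSemidef {n : ℕ} {f g : ℝ → ℝ} {A : Matrix (Fin n) (Fin n) ℂ}
    (hA : A.IsHermitian) (h : ∀ i, g (hA.eigenvalues i) ≤ f (hA.eigenvalues i)) :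
    (matFn f A hA - matFn g A hA).PosSemidef := by
  rw [matFn, matFn, ← Matrix.sub_mul, ← Matrix.mul_sub, Matrix.diagonal_sub]
  refine Matrix.PosSemidef.mul_mul_conjTranspose_same (Matrix.PosSemidef.diagonal ?_) _
  intro i
  simpa using h i

theorem matFn_posSemidef {n : ℕ} {f : ℝ → ℝ} {A : Matrix (Fin n) (Fin n) ℂ}
    (hA : A.IsHermitian) (h : ∀ i, 0 ≤ f (hA.eigenvalues i)) :
    (matFn f A hA).PosSemidef := by
  have := matFn_sub_matFn_posSemidef (f := f) (g := fun _ => 0) hA h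
  rwa [matFn_const, Complex.ofReal_zero, zero_smul, sub_zero] at this

theorem eigenvalues_le_of_posSemidef_sub {n : ℕ} {A : Matrix (Fin n) (Fin n) ℂ}
    (hA : A.IsHermitian) {c : ℝ} (h : ((c : ℂ) • 1 - A).PosSemidef) (i : Fin n) :
    hA.eigenvalues i ≤ c := by
  set U : Matrix (Fin n) (Fin n) ℂ := (hA.eigenvectorUnitary : Matrix (Fin n) (Fin n) ℂ)
  have hUU : Uᴴ * U = 1 := Unitary.coe_star_mul_self hA.eigenvectorUnitary
  have key : Uᴴ * ((c : ℂ) • 1 - A) * U =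
      Matrix.diagonal (fun j => ((c - hA.eigenvalues j : ℝ) : ℂ)) := by
    have hA' : A = U * Matrix.diagonal (fun j => (hA.eigenvalues j : ℂ)) * Uᴴ :=
      (matFn_id A hA).symm
    have hD : Uᴴ * A * U = Matrix.diagonal (fun j => (hA.eigenvalues j : ℂ)) := by
      calc Uᴴ * A * U
          = (Uᴴ * U) * Matrix.diagonal (fun j => (hA.eigenvalues j : ℂ)) * (Uᴴ * U) := by
            conv_lhs => rw [hA']
            simp only [Matrix.mul_assoc]
        _ = _ := by rw [hUU, one_mul, mul_one]
    rw [Matrix.mul_sub, Matrix.sub_mul, hD, Matrix.mul_smul, Matrix.smul_mul, mul_one, hUU,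
      Matrix.smul_one_eq_diagonal, Matrix.diagonal_sub]
    simp
  have hpos := (h.conjTranspose_mul_mul_same U).diag_nonneg (i := i)
  rw [key, Matrix.diagonal_apply_eq] at hpos
  have := Complex.zero_le_real.1 hpos
  linarith

/-- A concave function on `[0, ∞)` that is bounded below by `0` is nondecreasing. -/
theorem ConcaveOn.monotoneOn_Ici_of_nonneg {f : ℝ → ℝ} (hf : ConcaveOn ℝ (Set.Ici 0) f)
    (hf0 : ∀ x ∈ Set.Ici (0 : ℝ), 0 ≤ f x) : MonotoneOn f (Set.Ici 0) := by
  intro x hx y hy hxy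
  by_contra! hlt
  have hfy := hf0 y hy
  have hfx : 0 < f x := hfy.trans_lt hlt
  set t := (f x - f y) / (2 * f x) with ht
  have ht0 : 0 < t := div_pos (by linarith) (by linarith)
  have ht1 : t ≤ 1 := (div_le_one (by linarith)).2 (by linarith)
  have hz : x + (y - x) / t ∈ Set.Ici (0 : ℝ) := by
    have : 0 ≤ (y - x) / t := div_nonneg (by linarith) ht0.le
    simp only [Set.mem_Ici] at hx ⊢
    linarith
  have hc := hf.2 hx hz (sub_nonneg.2 ht1) ht0.le (by ring)
  have hcomb : (1 - t) • x + t • (x + (y - x) / t) = y := by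
    simp only [smul_eq_mul]
    field_simp
    ring
  rw [hcomb] at hc
  simp only [smul_eq_mul] at hc
  have h1 := mul_nonneg ht0.le (hf0 _ hz)
  have h2 : t * f x = (f x - f y) / 2 := by
    rw [ht]
    field_simp
  nlinarith

/-- A nonnegative concave function on `[0, ∞)` lies above its chords through the origin. -/
theorem ConcaveOn.div_mul_le_of_nonneg {f : ℝ → ℝ} (hf : ConcaveOn ℝ (Set.Ici 0) f)
    (h0 : 0 ≤ f 0) {l t : ℝ} (hl : 0 < l) (ht : 0 ≤ t) (htl : t ≤ l) :
    f l / l * t ≤ f t := by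
  have hs1 : t / l ≤ 1 := (div_le_one hl).2 htl
  have hc := hf.2 (Set.mem_Ici.2 le_rfl) (Set.mem_Ici.2 hl.le) (sub_nonneg.2 hs1)
    (div_nonneg ht hl.le) (by ring)
  have hcomb : (1 - t / l) • (0 : ℝ) + (t / l) • l = t := by
    simp only [smul_eq_mul]
    field_simp
    ring
  rw [hcomb] at hc
  simp only [smul_eq_mul] at hc
  have h1 := mul_nonneg (sub_nonneg.2 hs1) h0
  have h2 : f l / l * t = t / l * f l := by ring
  linarith

/-- Theorem 2.2 for the operator norm: for positive semidefinite `A`, `B` and a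
non-negative concave function `f` on `[0,∞)`, the operator norm (largest singular value)
of `f(A+B)` is at most that of `f(A) + f(B)`. -/
theorem opNorm_concave_subadditive {n : ℕ} (A B : Matrix (Fin n) (Fin n) ℂ)
    (hA : A.PosSemidef) (hB : B.PosSemidef)
    (f : ℝ → ℝ) (hf : ConcaveOn ℝ (Set.Ici 0) f)
    (hf0 : ∀ x ∈ Set.Ici (0 : ℝ), 0 ≤ f x) :
    ‖Matrix.toEuclideanCLM (𝕜 := ℂ) (matFn f _ (hA.1.add hB.1))‖ ≤
    ‖Matrix.toEuclideanCLM (𝕜 := ℂ) (matFn f A hA.1 + matFn f B hB.1)‖ := by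
  have hC := hA.1.add hB.1
  have hCp : ∀ i, 0 ≤ hC.eigenvalues i := (hA.add hB).eigenvalues_nonneg
  rw [norm_toEuclideanCLM_matFn, pi_norm_le_iff_of_nonneg (norm_nonneg _)]
  intro j
  have : Nonempty (Fin n) := ⟨j⟩
  obtain ⟨m, hm⟩ := Finite.exists_max hC.eigenvalues
  set l := hC.eigenvalues m with hl
  have hl0 : 0 ≤ l := hCp m
  have hfj : ‖((f (hC.eigenvalues j) : ℝ) : ℂ)‖ ≤ f l := by
    rw [Complex.norm_real, Real.norm_of_nonneg (hf0 _ (hCp j))]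
    exact hf.monotoneOn_Ici_of_nonneg hf0 (hCp j) hl0 (hm j)
  refine hfj.trans ?_
  have hCl : ((l : ℂ) • 1 - (A + B)).PosSemidef := by
    have := matFn_sub_matFn_posSemidef (f := fun _ => l) (g := fun t => t) hC hm
    rwa [matFn_const, matFn_id] at this
  have hAl : ∀ i, hA.1.eigenvalues i ≤ l := eigenvalues_le_of_posSemidef_sub hA.1 <| by
    convert hCl.add hB using 1
    abel
  have hBl : ∀ i, hB.1.eigenvalues i ≤ l := eigenvalues_le_of_posSemidef_sub hB.1 <| by
    convert hCl.add hA using 1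
    abel
  suffices H : ∃ h : ℝ → ℝ, h l = f l ∧ (∀ i, 0 ≤ h (hC.eigenvalues i)) ∧
      (matFn f A hA.1 + matFn f B hB.1 - matFn h _ hC).PosSemidef by
    obtain ⟨h, hhl, hh0, hle⟩ := H
    have h1 := norm_toEuclideanCLM_le_of_posSemidef (matFn_posSemidef hC hh0) hle
    rw [norm_toEuclideanCLM_matFn] at h1
    refine le_trans ?_ ((norm_le_pi_norm _ m).trans h1)
    rw [Complex.norm_real, ← hl, hhl]
    exact le_abs_self _
  rcases hl0.eq_or_lt with hzero | hpos
  · refine ⟨fun _ => f l, rfl, fun _ => hf0 l hl0, ?_⟩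
    have hA0 : (matFn f A hA.1 - matFn (fun _ => f l) A hA.1).PosSemidef :=
      matFn_sub_matFn_posSemidef hA.1 fun i => by
        rw [((hAl i).antisymm (hzero ▸ hA.eigenvalues_nonneg i) : hA.1.eigenvalues i = l)]
    convert hA0.add (matFn_posSemidef hB.1 fun i => hf0 _ (hB.eigenvalues_nonneg i)) using 1
    rw [matFn_const, matFn_const]
    abel
  · have h00 : 0 ≤ f 0 := hf0 0 (Set.mem_Ici.2 le_rfl)
    refine ⟨fun t => f l / l * t, div_mul_cancel₀ _ hpos.ne',
      fun i => mul_nonneg (div_nonneg (hf0 l hl0) hl0) (hCp i), ?_⟩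
    have hA0 : (matFn f A hA.1 - matFn (fun t => f l / l * t) A hA.1).PosSemidef :=
      matFn_sub_matFn_posSemidef hA.1 fun i =>
        hf.div_mul_le_of_nonneg h00 hpos (hA.eigenvalues_nonneg i) (hAl i)
    have hB0 : (matFn f B hB.1 - matFn (fun t => f l / l * t) B hB.1).PosSemidef :=
      matFn_sub_matFn_posSemidef hB.1 fun i =>
        hf.div_mul_le_of_nonneg h00 hpos (hB.eigenvalues_nonneg i) (hBl i)
    convert hA0.add hB0 using 1
    simp only [matFn_mul_left (f l / l) (fun t => t), matFn_id, smul_add]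
    abel
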